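/- arXiv:1203.0021 — 2 statements merged into one kernel-verified Lean document; each statement's English description precedes it below -/
import Mathlib

section
/- Let ℱ ∈ Σ_max and p ∈ P. Then pℱ ∈ Σ_max, and if moreover pP ∈ ℱ, then also p⁻¹ℱ ∈ Σ_max. In particular, Σ_max is an invariant subset of Σ. -/
variable {G : Type*} [Group G]

/-- Left translate `g·X = {gx : x ∈ X}`. -/
def lmul (g : G) (X : Set G) : Set G := (g * ·) '' X

/-- `p⁻¹X = {y ∈ P : py ∈ X}`. -/
def presub (P : Submonoid G) (p : G) (X : Set G) : Set G := {y : G | y ∈ P ∧ p * y ∈ X}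

/-- The constructible right ideals of `P`: the smallest family of subsets of `P`
containing `∅` and `P` and closed under `X ↦ pX` and `X ↦ p⁻¹X` for `p ∈ P`. -/
inductive IsConstructible (P : Submonoid G) : Set G → Prop
  | empty : IsConstructible P ∅
  | base : IsConstructible P (P : Set G)
  | mul {p : G} (hp : p ∈ P) {X : Set G} (hX : IsConstructible P X) : IsConstructible P (lmul p X)
  | pre {p : G} (hp : p ∈ P) {X : Set G} (hX : IsConstructible P X) :
      IsConstructible P (presub P p X)

/-- `𝒥_P^G`: the smallest family of subsets of `G` containing `𝒥`, closed under left
translations by group elements and under finite intersections. -/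
inductive IsConstructibleG (P : Submonoid G) : Set G → Prop
  | base {X : Set G} (hX : IsConstructible P X) : IsConstructibleG P X
  | translate (g : G) {Y : Set G} (hY : IsConstructibleG P Y) : IsConstructibleG P (lmul g Y)
  | inter {Y₁ Y₂ : Set G} (h1 : IsConstructibleG P Y₁) (h2 : IsConstructibleG P Y₂) :
      IsConstructibleG P (Y₁ ∩ Y₂)

/-- A family of subsets (containing `∅` and closed under finite intersections) is
independent if whenever a member equals a finite union of members, it equals one of them. -/
def IsIndepFamily {α : Type*} (J : Set (Set α)) : Prop :=
  ∀ X ∈ J, ∀ n : ℕ, 0 < n → ∀ Xs : Fin n → Set α,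
    (∀ i, Xs i ∈ J) → X = ⋃ i, Xs i → ∃ i, X = Xs i

/-- The Toeplitz condition for `P ⊆ G` (set-theoretic form): for every `g ∈ G` with
`{x ∈ P : gx ∈ P} ≠ ∅` there are `p₁, q₁, …, pₙ, qₙ ∈ P` (`n ≥ 1`) with
`g = p₁⁻¹q₁⋯pₙ⁻¹qₙ` and `{x ∈ P : gx ∈ P} = qₙ⁻¹(pₙ(⋯(q₁⁻¹(p₁P))⋯))`. -/
def IsToeplitz (P : Submonoid G) : Prop :=
  ∀ g : G, {x : G | x ∈ P ∧ g * x ∈ P}.Nonempty →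
    ∃ l : List (G × G), l ≠ [] ∧ (∀ pq ∈ l, pq.1 ∈ P ∧ pq.2 ∈ P) ∧
      g = (l.map fun pq => pq.1⁻¹ * pq.2).prod ∧
      {x : G | x ∈ P ∧ g * x ∈ P} =
        l.foldl (fun S pq => presub P pq.2 (lmul pq.1 S)) (P : Set G)

/-- A `J`-valued filter. -/
def IsFilterOn {α : Type*} (J : Set (Set α)) (F : Set (Set α)) : Prop :=
  F ⊆ J ∧ (∀ X₁ ∈ F, ∀ X₂ ∈ J, X₁ ⊆ X₂ → X₂ ∈ F) ∧
    (∀ X₁ ∈ F, ∀ X₂ ∈ F, X₁ ∩ X₂ ∈ F) ∧ ∅ ∉ F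

/-- `pℱ = {X ∈ 𝒥 : p⁻¹X ∈ ℱ}`. -/
def fwdF (P : Submonoid G) (p : G) (F : Set (Set G)) : Set (Set G) :=
  {X : Set G | IsConstructible P X ∧ presub P p X ∈ F}

/-- `p⁻¹𝒢 = {X ∈ 𝒥 : pX ∈ 𝒢}`. -/
def bwdF (P : Submonoid G) (p : G) (F : Set (Set G)) : Set (Set G) :=
  {X : Set G | IsConstructible P X ∧ lmul p X ∈ F}

/-- `ℱ` is a `𝒥`-valued ultrafilter: a maximal element of `Σ` w.r.t. inclusion. -/
def IsUltraFilterOn (P : Submonoid G) (F : Set (Set G)) : Prop :=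
  (IsFilterOn {X : Set G | IsConstructible P X} F ∧ F.Nonempty) ∧
    ∀ F' : Set (Set G), IsFilterOn {X : Set G | IsConstructible P X} F' → F'.Nonempty →
      F ⊆ F' → F' = F

theorem IsConstructible.subset {P : Submonoid G} {X : Set G} (hX : IsConstructible P X) :
    X ⊆ (P : Set G) := by
  induction hX with
  | empty => exact Set.empty_subset _
  | base => exact subset_rfl
  | mul hp _ ih =>
    rintro _ ⟨x, hx, rfl⟩
    exact P.mul_mem hp (ih hx)
  | pre _ _ _ => exact fun _ hy => hy.1

theorem presub_lmul {P : Submonoid G} {X : Set G} (hX : X ⊆ (P : Set G)) (p : G) :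
    presub P p (lmul p X) = X := by
  ext y
  refine ⟨?_, fun hy => ⟨hX hy, y, hy, rfl⟩⟩
  rintro ⟨-, x, hx, hxy⟩
  exact mul_left_cancel hxy ▸ hx

theorem lmul_presub (P : Submonoid G) (p : G) (X : Set G) :
    lmul p (presub P p X) = X ∩ lmul p (P : Set G) := by
  ext y
  constructor
  · rintro ⟨x, ⟨hxP, hx⟩, rfl⟩
    exact ⟨hx, x, hxP, rfl⟩
  · rintro ⟨hy, x, hx, rfl⟩
    exact ⟨x, ⟨hx, hy⟩, rfl⟩

theorem lmul_mono (p : G) {X Y : Set G} (h : X ⊆ Y) : lmul p X ⊆ lmul p Y :=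
  Set.image_mono h

theorem lmul_inter (p : G) (X Y : Set G) : lmul p (X ∩ Y) = lmul p X ∩ lmul p Y :=
  Set.image_inter (mul_right_injective p)

theorem lmul_inter_eq {P : Submonoid G} {p : G} {X Y : Set G} (hX : X ⊆ (P : Set G)) :
    lmul p X ∩ Y = lmul p (X ∩ presub P p Y) := by
  rw [lmul_inter, lmul_presub, ← Set.inter_assoc, Set.inter_right_comm,
    Set.inter_eq_left.2 (lmul_mono p hX)]

theorem presub_inter (P : Submonoid G) (p : G) (X Y : Set G) :
    presub P p (X ∩ Y) = presub P p X ∩ presub P p Y := by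
  ext y
  simp only [presub, Set.mem_ofPred_eq, Set.mem_inter_iff]
  tauto

theorem IsConstructible.inter {P : Submonoid G} {X Y : Set G} (hX : IsConstructible P X)
    (hY : IsConstructible P Y) : IsConstructible P (X ∩ Y) := by
  induction hX generalizing Y with
  | empty => simpa using IsConstructible.empty
  | base => rwa [Set.inter_eq_right.2 hY.subset]
  | mul hp hX ih =>
    rw [lmul_inter_eq hX.subset]
    exact .mul hp (ih (.pre hp hY))
  | @pre p hp X _ ih =>
    rw [← presub_lmul hY.subset p, ← presub_inter]
    exact .pre hp (ih (.mul hp hY))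

theorem IsFilterOn.base_mem {P : Submonoid G} {F : Set (Set G)}
    (hF : IsFilterOn {X : Set G | IsConstructible P X} F) (hne : F.Nonempty) :
    (P : Set G) ∈ F := by
  obtain ⟨X, hX⟩ := hne
  exact hF.2.1 X hX _ .base (hF.1 hX).subset

theorem IsFilterOn.fwdF {P : Submonoid G} {F : Set (Set G)}
    (hF : IsFilterOn {X : Set G | IsConstructible P X} F) {p : G} (hp : p ∈ P) :
    IsFilterOn {X : Set G | IsConstructible P X} (fwdF P p F) := by
  obtain ⟨-, hup, hinter, hempty⟩ := hF
  refine ⟨fun X hX => hX.1, fun X hX Y hY hXY => ⟨hY, ?_⟩,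
    fun X hX Y hY => ⟨hX.1.inter hY.1, ?_⟩, fun h => hempty ?_⟩
  · exact hup _ hX.2 _ (.pre hp hY) fun y hy => ⟨hy.1, hXY hy.2⟩
  · rw [presub_inter]
    exact hinter _ hX.2 _ hY.2
  · simpa [presub] using h.2

theorem IsFilterOn.bwdF {P : Submonoid G} {F : Set (Set G)}
    (hF : IsFilterOn {X : Set G | IsConstructible P X} F) {p : G} (hp : p ∈ P) :
    IsFilterOn {X : Set G | IsConstructible P X} (bwdF P p F) := by
  obtain ⟨-, hup, hinter, hempty⟩ := hF
  refine ⟨fun X hX => hX.1, fun X hX Y hY hXY => ⟨hY, ?_⟩,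
    fun X hX Y hY => ⟨hX.1.inter hY.1, ?_⟩, fun h => hempty ?_⟩
  · exact hup _ hX.2 _ (.mul hp hY) (lmul_mono p hXY)
  · rw [lmul_inter]
    exact hinter _ hX.2 _ hY.2
  · simpa [lmul] using h.2

theorem lmul_mem_fwdF {P : Submonoid G} {F : Set (Set G)} {p : G} (hp : p ∈ P) {X : Set G}
    (hX : IsConstructible P X) (hXF : X ∈ F) : lmul p X ∈ fwdF P p F :=
  ⟨.mul hp hX, by rwa [presub_lmul hX.subset]⟩

theorem presub_mem_bwdF {P : Submonoid G} {F : Set (Set G)}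
    (hF : IsFilterOn {X : Set G | IsConstructible P X} F) {p : G} (hp : p ∈ P)
    (hpP : lmul p (P : Set G) ∈ F) {X : Set G} (hX : X ∈ F) : presub P p X ∈ bwdF P p F :=
  ⟨.pre hp (hF.1 hX), by rw [lmul_presub]; exact hF.2.2.1 _ hX _ hpP⟩

theorem IsUltraFilterOn.fwdF {P : Submonoid G} {F : Set (Set G)} (hF : IsUltraFilterOn P F)
    {p : G} (hp : p ∈ P) : IsUltraFilterOn P (fwdF P p F) := by
  obtain ⟨⟨hfil, hne⟩, hmax⟩ := hF
  have hpP := lmul_mem_fwdF hp .base (hfil.base_mem hne)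
  refine ⟨⟨hfil.fwdF hp, _, hpP⟩, fun F' hF' _ hsub => (Set.Subset.antisymm hsub ?_).symm⟩
  have heq : _root_.bwdF P p F' = F := hmax _ (hF'.bwdF hp) ⟨_, .base, hsub hpP⟩
    fun X hX => ⟨hfil.1 hX, hsub (lmul_mem_fwdF hp (hfil.1 hX) hX)⟩
  exact fun X hX => ⟨hF'.1 hX, heq ▸ presub_mem_bwdF hF' hp (hsub hpP) hX⟩

theorem IsUltraFilterOn.bwdF {P : Submonoid G} {F : Set (Set G)} (hF : IsUltraFilterOn P F)
    {p : G} (hp : p ∈ P) (hpP : lmul p (P : Set G) ∈ F) : IsUltraFilterOn P (bwdF P p F) := by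
  obtain ⟨⟨hfil, -⟩, hmax⟩ := hF
  refine ⟨⟨hfil.bwdF hp, _, .base, hpP⟩,
    fun F' hF' hne' hsub => (Set.Subset.antisymm hsub ?_).symm⟩
  have heq : _root_.fwdF P p F' = F := hmax _ (hF'.fwdF hp)
    ⟨_, lmul_mem_fwdF hp .base (hF'.base_mem hne')⟩
    fun X hX => ⟨hfil.1 hX, hsub (presub_mem_bwdF hfil hp hpP hX)⟩
  exact fun X hX => ⟨hF'.1 hX, heq ▸ lmul_mem_fwdF hp (hF'.1 hX) hX⟩

/-- If `ℱ ∈ Σ_max` and `p ∈ P`, then `pℱ ∈ Σ_max`; if moreover `pP ∈ ℱ`, then also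
`p⁻¹ℱ ∈ Σ_max`. In particular, `Σ_max` is an invariant subset of `Σ`. -/
theorem stmt_10 (P : Submonoid G) (F : Set (Set G)) (hF : IsUltraFilterOn P F)
    (p : G) (hp : p ∈ P) :
    IsUltraFilterOn P (fwdF P p F) ∧
      (lmul p (P : Set G) ∈ F → IsUltraFilterOn P (bwdF P p F)) :=
  ⟨hF.fwdF hp, hF.bwdF hp⟩
end

section
/- 𝒥_P^G = {∅} ∪ {g₁·P ∩ g₂·P ∩ ⋯ ∩ gₙ·P : n ≥ 1, g₁, …, gₙ ∈ G}. In particular, every nonempty constructible right ideal X ∈ 𝒥 is a finite intersection of left translates g·P with g ∈ G. -/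
variable {G : Type*} [Group G]

theorem mem_lmul {g x : G} {X : Set G} : x ∈ lmul g X ↔ g⁻¹ * x ∈ X :=
  ⟨by rintro ⟨y, hy, rfl⟩; simpa using hy, fun h => ⟨g⁻¹ * x, h, by simp⟩⟩

theorem lmul_empty (g : G) : lmul g (∅ : Set G) = ∅ := Set.image_empty _

theorem lmul_one (X : Set G) : lmul 1 X = X := by
  ext x
  simp [mem_lmul]

theorem presub_eq_inter (P : Submonoid G) (p : G) (X : Set G) :
    presub P p X = (P : Set G) ∩ lmul p⁻¹ X := by
  ext x
  simp [mem_lmul, presub]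

/-- `Y` is a nonempty finite intersection of left translates of `P`. -/
def IsTranslateInter (P : Submonoid G) (Y : Set G) : Prop :=
  ∃ n : ℕ, 0 < n ∧ ∃ g : Fin n → G, Y = ⋂ i, lmul (g i) (P : Set G)

namespace IsTranslateInter

variable {P : Submonoid G} {Y Z : Set G}

theorem self (P : Submonoid G) : IsTranslateInter P (P : Set G) :=
  ⟨1, one_pos, fun _ => 1, by ext; simp [lmul_one]⟩

theorem translate (h : G) (hY : IsTranslateInter P Y) : IsTranslateInter P (lmul h Y) := by
  obtain ⟨n, hn, g, rfl⟩ := hY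
  refine ⟨n, hn, fun i => h * g i, ?_⟩
  ext x
  simp [mem_lmul, mul_assoc]

theorem inter (hY : IsTranslateInter P Y) (hZ : IsTranslateInter P Z) :
    IsTranslateInter P (Y ∩ Z) := by
  obtain ⟨m, hm, g, rfl⟩ := hY
  obtain ⟨n, -, k, rfl⟩ := hZ
  refine ⟨m + n, by omega, Fin.append g k, ?_⟩
  ext x
  simp only [Set.mem_inter_iff, Set.mem_iInter]
  refine ⟨fun hx i => ?_, fun hx => ⟨fun i => ?_, fun i => ?_⟩⟩
  · induction i using Fin.addCases with
    | left i => simpa using hx.1 i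
    | right i => simpa using hx.2 i
  · simpa using hx (Fin.castAdd n i)
  · simpa using hx (Fin.natAdd m i)

end IsTranslateInter

theorem IsConstructible.eq_empty_or_isTranslateInter {P : Submonoid G} {X : Set G}
    (hX : IsConstructible P X) : X = ∅ ∨ IsTranslateInter P X := by
  induction hX with
  | empty => exact .inl rfl
  | base => exact .inr (.self P)
  | mul _ _ ih =>
    rcases ih with rfl | h
    · exact .inl (lmul_empty _)
    · exact .inr (h.translate _)
  | pre _ _ ih =>
    rw [presub_eq_inter]
    rcases ih with rfl | h
    · exact .inl (by rw [lmul_empty, Set.inter_empty])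
    · exact .inr ((IsTranslateInter.self P).inter (h.translate _))

theorem IsConstructibleG.eq_empty_or_isTranslateInter {P : Submonoid G} {Y : Set G}
    (hY : IsConstructibleG P Y) : Y = ∅ ∨ IsTranslateInter P Y := by
  induction hY with
  | base hX => exact hX.eq_empty_or_isTranslateInter
  | translate g _ ih =>
    rcases ih with rfl | h
    · exact .inl (lmul_empty g)
    · exact .inr (h.translate g)
  | inter _ _ ih₁ ih₂ =>
    rcases ih₁ with rfl | h₁
    · exact .inl (Set.empty_inter _)
    rcases ih₂ with rfl | h₂
    · exact .inl (Set.inter_empty _)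
    exact .inr (h₁.inter h₂)

theorem isConstructibleG_iInter_lmul (P : Submonoid G) {n : ℕ} (g : Fin (n + 1) → G) :
    IsConstructibleG P (⋂ i, lmul (g i) (P : Set G)) := by
  induction n with
  | zero =>
    have h : ⋂ i, lmul (g i) (P : Set G) = lmul (g 0) (P : Set G) := by
      ext x
      simp [Fin.forall_fin_one]
    rw [h]
    exact .translate _ (.base .base)
  | succ n ih =>
    have h : ⋂ i, lmul (g i) (P : Set G) =
        lmul (g 0) (P : Set G) ∩ ⋂ i : Fin (n + 1), lmul (g i.succ) (P : Set G) := by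
      ext x
      simp only [Set.mem_inter_iff, Set.mem_iInter, Fin.forall_fin_succ (n := n + 1)]
    rw [h]
    exact .inter (.translate _ (.base .base)) (ih fun i => g i.succ)

/-- `𝒥_P^G = {∅} ∪ {g₁·P ∩ ⋯ ∩ gₙ·P : n ≥ 1, gᵢ ∈ G}`; in particular every nonempty
`X ∈ 𝒥` is a finite intersection of left translates `g·P`. -/
theorem stmt_12 (P : Submonoid G) :
    ({Y : Set G | IsConstructibleG P Y} =
        insert (∅ : Set G)
          {Y : Set G | ∃ n : ℕ, 0 < n ∧ ∃ g : Fin n → G, Y = ⋂ i, lmul (g i) (P : Set G)}) ∧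
      ∀ X : Set G, IsConstructible P X → X ≠ ∅ →
        ∃ n : ℕ, 0 < n ∧ ∃ g : Fin n → G, X = ⋂ i, lmul (g i) (P : Set G) := by
  refine ⟨Set.Subset.antisymm (fun Y hY => hY.eq_empty_or_isTranslateInter) ?_,
    fun X hX hne => hX.eq_empty_or_isTranslateInter.resolve_left hne⟩
  rintro Y (rfl | ⟨n, hn, g, rfl⟩)
  · exact .base .empty
  · obtain ⟨m, rfl⟩ := Nat.exists_eq_add_one.mpr hn
    exact isConstructibleG_iInter_lmul P g
end
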